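/- Let (U₁,U₂,<) be a coherent extended word equation. If the cut graph G_{U₁,U₂,<} is acyclic, then (U₁,U₂,<) is terminating; moreover, every sequence of coherent extended Nielsen transformations starting from (U₁,U₂,<) has length at most 2^N, where N = |U₁| + |U₂|. -/

import Mathlib

open scoped Classical

namespace ExtWordEq

/-- The type of (candidate) boundary orders: relations on pairs (i,j). -/
abbrev BRel : Type := ℕ × ℕ → ℕ × ℕ → Prop

variable {X : Type*}

/-- The `i`-th side of the word equation (`i = 1` gives `U₁`, anything else `U₂`). -/
def word (U₁ U₂ : List X) (i : ℕ) : List X := if i = 1 then U₁ else U₂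

/-- The variable `U_{i,j}` (1-indexed), as an optional value. -/
def letter (U₁ U₂ : List X) (b : ℕ × ℕ) : Option X := (word U₁ U₂ b.1)[b.2 - 1]?

/-- `b` is a boundary of the word equation `(U₁, U₂)`. -/
def Boundary (U₁ U₂ : List X) (b : ℕ × ℕ) : Prop :=
  (b.1 = 1 ∨ b.1 = 2) ∧ 1 ≤ b.2 ∧ b.2 ≤ (word U₁ U₂ b.1).length

/-- `b` is a boundary of `(U₁, U₂)` or one of the conventional boundaries `(1,0)`, `(2,0)`. -/
def EBoundary (U₁ U₂ : List X) (b : ℕ × ℕ) : Prop :=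
  (b.1 = 1 ∨ b.1 = 2) ∧ b.2 ≤ (word U₁ U₂ b.1).length

/-- Incomparability `a ≈ b` for a strict order. -/
def Incomp (lt : BRel) (a b : ℕ × ℕ) : Prop := ¬ lt a b ∧ ¬ lt b a

/-- `lt` is a boundary order for the word equation `(U₁, U₂)`:
a strict weak order on the boundaries (together with the conventional boundaries
`(1,0) ≈ (2,0)`), extending `(i,j) < (i,j+1)` and with `(1,m) ≈ (2,n)`. -/
structure BoundaryOrder (U₁ U₂ : List X) (lt : BRel) : Prop where
  irrefl : ∀ a, EBoundary U₁ U₂ a → ¬ lt a a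
  trans : ∀ a b c, EBoundary U₁ U₂ a → EBoundary U₁ U₂ b → EBoundary U₁ U₂ c →
    lt a b → lt b c → lt a c
  incomp_trans : ∀ a b c, EBoundary U₁ U₂ a → EBoundary U₁ U₂ b → EBoundary U₁ U₂ c →
    Incomp lt a b → Incomp lt b c → Incomp lt a c
  succ : ∀ i j : ℕ, EBoundary U₁ U₂ (i, j + 1) → lt (i, j) (i, j + 1)
  top : Incomp lt (1, U₁.length) (2, U₂.length)
  bot : Incomp lt (1, 0) (2, 0)

/-- `L(U_{i,1} U_{i,2} ⋯ U_{i,j})` where `L` is the additive extension of a length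
assignment on variables. -/
def prefixLen (U₁ U₂ : List X) (L : X → ℕ) (b : ℕ × ℕ) : ℕ :=
  (((word U₁ U₂ b.1).take b.2).map L).sum

/-- The extended word equation `(U₁, U₂, lt)` is coherent. -/
def Coherent (U₁ U₂ : List X) (lt : BRel) : Prop :=
  ∃ L : X → ℕ, (∀ x, 0 < L x) ∧
    ∀ a b, Boundary U₁ U₂ a → Boundary U₁ U₂ b →
      (lt a b ↔ prefixLen U₁ U₂ L a < prefixLen U₁ U₂ L b)

/-- The boundary `a` cuts the boundary `b`. -/
def Cuts (U₁ U₂ : List X) (lt : BRel) (a b : ℕ × ℕ) : Prop :=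
  Boundary U₁ U₂ a ∧ Boundary U₁ U₂ b ∧ a ≠ b ∧
    lt (a.1, a.2 - 1) b ∧ lt (b.1, b.2 - 1) a

/-- The boundary `a` mirrors the boundary `b`. -/
def Mirrors (U₁ U₂ : List X) (lt : BRel) (a b : ℕ × ℕ) : Prop :=
  Boundary U₁ U₂ a ∧ Boundary U₁ U₂ b ∧ letter U₁ U₂ a = letter U₁ U₂ b ∧
    (¬ Incomp lt a b ∨ ¬ Incomp lt (a.1, a.2 - 1) (b.1, b.2 - 1))

/-- Edge relation of the cut graph `G_{U₁,U₂,<}`. -/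
def CutEdge (U₁ U₂ : List X) (lt : BRel) (a b : ℕ × ℕ) : Prop :=
  ∃ c, Cuts U₁ U₂ lt a c ∧ Mirrors U₁ U₂ lt c b

/-- `w 0, w 1, …, w n` is a cycle (of length `n ≥ 1`) in the cut graph. -/
def IsCycle (U₁ U₂ : List X) (lt : BRel) (n : ℕ) (w : ℕ → ℕ × ℕ) : Prop :=
  0 < n ∧ w n = w 0 ∧ ∀ k < n, CutEdge U₁ U₂ lt (w k) (w (k + 1))

/-- The cut graph `G_{U₁,U₂,<}` is acyclic. -/
def Acyclic (U₁ U₂ : List X) (lt : BRel) : Prop :=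
  ¬ ∃ n w, IsCycle U₁ U₂ lt n w

variable [DecidableEq X]

/-- Case I extended Nielsen transformation (here `x = U_{1,1}`, `y = U_{2,1}`,
and `T(y) = x`). -/
def NielsenI (U₁ U₂ : List X) (lt : BRel) (U₁' U₂' : List X) (lt' : BRel) : Prop :=
  ∃ x y : X, U₁.head? = some x ∧ U₂.head? = some y ∧
    Incomp lt (1, 1) (2, 1) ∧
    U₁' = (U₁.map fun z => if z = y then x else z).tail ∧
    U₂' = (U₂.map fun z => if z = y then x else z).tail ∧
    BoundaryOrder U₁' U₂' lt' ∧
    ∀ a b : ℕ × ℕ, EBoundary U₁' U₂' a → EBoundary U₁' U₂' b →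
      (lt' a b ↔ lt (a.1, a.2 + 1) (b.1, b.2 + 1))

/-- The substitution `T(x) = y x` (identity on other variables), applied to a word. -/
def expand (x y : X) (l : List X) : List X :=
  l.flatMap fun z => if z = x then [y, x] else [z]

/-- The map `μ(i,j) = j + #{j' ≤ j : U_{i,j'} = x} − 1` (as a map on boundaries),
where `x = U_{1,1}`. -/
def mu (U₁ U₂ : List X) (x : X) (b : ℕ × ℕ) : ℕ × ℕ :=
  (b.1, b.2 + ((word U₁ U₂ b.1).take b.2).count x - 1)

/-- The map `ν(i,j) = j − #{j' ≤ j : U'_{i,j'} = x} + 1` (as a map on boundaries),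
where `x = U_{1,1}`. -/
def nu (U₁' U₂' : List X) (x : X) (b : ℕ × ℕ) : ℕ × ℕ :=
  (b.1, b.2 - ((word U₁' U₂' b.1).take b.2).count x + 1)

/-- Membership in `B⁻ = B ∖ {(2,1)}`. -/
def Bminus (U₁ U₂ : List X) (b : ℕ × ℕ) : Prop := Boundary U₁ U₂ b ∧ b ≠ (2, 1)

/-- Membership in `B'⁻ = {(i, μ(i,j)) : (i,j) ∈ B⁻}` (`x = U_{1,1}`). -/
def Bpminus (U₁ U₂ : List X) (x : X) (b' : ℕ × ℕ) : Prop :=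
  ∃ b, Bminus U₁ U₂ b ∧ mu U₁ U₂ x b = b'

/-- Case II extended Nielsen transformation, with the heads `x = U_{1,1}`,
`y = U_{2,1}` made explicit. -/
def NielsenIIxy (U₁ U₂ : List X) (lt : BRel) (U₁' U₂' : List X) (lt' : BRel)
    (x y : X) : Prop :=
  U₁.head? = some x ∧ U₂.head? = some y ∧
  lt (2, 1) (1, 1) ∧
  U₁' = (expand x y U₁).tail ∧
  U₂' = (expand x y U₂).tail ∧
  BoundaryOrder U₁' U₂' lt' ∧
  ∀ a b, Bpminus U₁ U₂ x a → Bpminus U₁ U₂ x b →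
    (lt' a b ↔ lt (nu U₁' U₂' x a) (nu U₁' U₂' x b))

/-- Case II extended Nielsen transformation. -/
def NielsenII (U₁ U₂ : List X) (lt : BRel) (U₁' U₂' : List X) (lt' : BRel) : Prop :=
  ∃ x y : X, NielsenIIxy U₁ U₂ lt U₁' U₂' lt' x y

/-- The dual boundary order. -/
def dualRel (lt : BRel) : BRel := fun a b => lt (3 - a.1, a.2) (3 - b.1, b.2)

/-- Case III extended Nielsen transformation: case II applied to the dual,
then dualized back. -/
def NielsenIII (U₁ U₂ : List X) (lt : BRel) (U₁' U₂' : List X) (lt' : BRel) : Prop :=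
  NielsenII U₂ U₁ (dualRel lt) U₂' U₁' (dualRel lt')

/-- `(U₁', U₂', lt')` is an extended Nielsen transformation of the nontrivial coherent
extended word equation `(U₁, U₂, lt)`. -/
def ExtNielsen (U₁ U₂ : List X) (lt : BRel) (U₁' U₂' : List X) (lt' : BRel) : Prop :=
  U₁ ≠ [] ∧ U₂ ≠ [] ∧ BoundaryOrder U₁ U₂ lt ∧ Coherent U₁ U₂ lt ∧
    (NielsenI U₁ U₂ lt U₁' U₂' lt' ∨ NielsenII U₁ U₂ lt U₁' U₂' lt' ∨
      NielsenIII U₁ U₂ lt U₁' U₂' lt')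

/-- A coherent extended Nielsen transformation. -/
def CohNielsen (U₁ U₂ : List X) (lt : BRel) (U₁' U₂' : List X) (lt' : BRel) : Prop :=
  ExtNielsen U₁ U₂ lt U₁' U₂' lt' ∧ Coherent U₁' U₂' lt'

/-- `(U₁, U₂, lt)` is (strongly) terminating: there is no infinite sequence of coherent
extended Nielsen transformations starting from it. -/
def Terminating (U₁ U₂ : List X) (lt : BRel) : Prop :=
  ¬ ∃ f : ℕ → List X × List X × BRel,
    f 0 = (U₁, U₂, lt) ∧
    ∀ n, CohNielsen (f n).1 (f n).2.1 (f n).2.2 (f (n + 1)).1 (f (n + 1)).2.1 (f (n + 1)).2.2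

set_option linter.unusedSectionVars false

/-- An occurrence of a variable in a word equation, placed on the number line and weighted. -/
structure Tok (X : Type*) where
  start : ℤ
  finish : ℤ
  lab : X
  wt : ℕ

/-- The total weight of the occurrences in `t` mirroring the occurrence `c`. -/
def mirrorWt (c : Tok X) (t : List (Tok X)) : ℕ :=
  (t.map fun d => if d.lab = c.lab ∧ d.finish ≠ c.finish then d.wt else 0).sum

/-- Every occurrence outweighs the mirrors of each occurrence it cuts. -/
def Good (t₁ t₂ : List (Tok X)) : Prop :=
  ∀ a ∈ t₁, ∀ c ∈ t₂, a.start < c.finish → c.start < a.finish →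
    1 + (mirrorWt c t₁ + mirrorWt c t₂) ≤ a.wt ∧ 1 + (mirrorWt a t₁ + mirrorWt a t₂) ≤ c.wt

/-- The occurrences of a weighted word laid out from position `o`. -/
def toks (L : X → ℕ) : ℤ → List (X × ℕ) → List (Tok X)
  | _, [] => []
  | o, (z, w) :: l => ⟨o, o + L z, z, w⟩ :: toks L (o + L z) l

/-- `L` witnesses the coherence of `(U₁, U₂, lt)`. -/
def CohWitness (U₁ U₂ : List X) (lt : BRel) (L : X → ℕ) : Prop :=
  (∀ x, 0 < L x) ∧ ∀ a b, Boundary U₁ U₂ a → Boundary U₁ U₂ b →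
    (lt a b ↔ prefixLen U₁ U₂ L a < prefixLen U₁ U₂ L b)

/-- The equation admits a weighting of total weight `n` that is good for every witness
of coherence. -/
def Weighted (U₁ U₂ : List X) (lt : BRel) (n : ℕ) : Prop :=
  ∃ w₁ w₂ : List (X × ℕ), w₁.map Prod.fst = U₁ ∧ w₂.map Prod.fst = U₂ ∧
    (w₁.map Prod.snd).sum + (w₂.map Prod.snd).sum = n ∧
    ∀ L, CohWitness U₁ U₂ lt L → ∀ o : ℤ, Good (toks L o w₁) (toks L o w₂)

@[simp] theorem mirrorWt_nil (c : Tok X) : mirrorWt c [] = 0 := rfl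

@[simp] theorem mirrorWt_cons (c d : Tok X) (t : List (Tok X)) :
    mirrorWt c (d :: t) =
      (if d.lab = c.lab ∧ d.finish ≠ c.finish then d.wt else 0) + mirrorWt c t := by
  simp [mirrorWt]

theorem mirrorWt_append (c : Tok X) (t u : List (Tok X)) :
    mirrorWt c (t ++ u) = mirrorWt c t + mirrorWt c u := by
  simp [mirrorWt]

theorem Good.symm {t₁ t₂ : List (Tok X)} (h : Good t₁ t₂) : Good t₂ t₁ := by
  intro a ha c hc h₁ h₂
  have := h c hc a ha h₂ h₁
  omega

theorem mirrorWt_flatMap_le {s : Tok X → List (Tok X)} {c c' h : Tok X} {t : List (Tok X)}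
    (H : ∀ d ∈ t, mirrorWt c' (s d) ≤ mirrorWt c [d] + mirrorWt h [d]) :
    mirrorWt c' (t.flatMap s) ≤ mirrorWt c t + mirrorWt h t := by
  induction t with
  | nil => simp
  | cons d t ih =>
    have h₁ := H d (by simp)
    have h₂ := ih fun e he => H e (by simp [he])
    simp only [List.flatMap_cons, mirrorWt_append, mirrorWt_cons, mirrorWt_nil] at *
    omega

theorem mirrorWt_flatMap_le_self {s : Tok X → List (Tok X)} {c c' : Tok X} {t : List (Tok X)}
    (H : ∀ d ∈ t, mirrorWt c' (s d) ≤ mirrorWt c [d]) :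
    mirrorWt c' (t.flatMap s) ≤ mirrorWt c t := by
  induction t with
  | nil => simp
  | cons d t ih =>
    have h₁ := H d (by simp)
    have h₂ := ih fun e he => H e (by simp [he])
    simp only [List.flatMap_cons, mirrorWt_append, mirrorWt_cons, mirrorWt_nil] at *
    omega

/-- Replace the letter `y` by `x`. -/
def Tok.recolor (x y : X) (d : Tok X) : Tok X :=
  { d with lab := if d.lab = y then x else d.lab }

/-- Cut an occurrence of `x` into an occurrence of `y` of length `k` followed by one of `x`. -/
def Tok.split (x y : X) (k : ℤ) (d : Tok X) : List (Tok X) :=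
  if d.lab = x then [⟨d.start, d.start + k, y, d.wt⟩, ⟨d.start + k, d.finish, x, d.wt⟩] else [d]

theorem Good.recolor {h₁ h₂ : Tok X} {t₁ t₂ : List (Tok X)} (hG : Good (h₁ :: t₁) (h₂ :: t₂))
    (hs : h₁.finish = h₂.finish) (hlt₁ : h₁.start < h₂.finish) (hlt₂ : h₂.start < h₁.finish)
    (ht : ∀ d ∈ t₁ ++ t₂, d.finish ≠ h₁.finish) :
    Good (t₁.flatMap fun d => [d.recolor h₁.lab h₂.lab])
      (t₂.flatMap fun d => [d.recolor h₁.lab h₂.lab]) := by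
  have key : ∀ c ∈ t₁ ++ t₂,
      mirrorWt (c.recolor h₁.lab h₂.lab) (t₁.flatMap fun d => [d.recolor h₁.lab h₂.lab]) +
      mirrorWt (c.recolor h₁.lab h₂.lab) (t₂.flatMap fun d => [d.recolor h₁.lab h₂.lab]) ≤
      mirrorWt c (h₁ :: t₁) + mirrorWt c (h₂ :: t₂) := by
    intro c hc
    have hcs := ht c hc
    have hcs' : h₁.finish ≠ c.finish := fun h => hcs h.symm
    have hcs'' : h₂.finish ≠ c.finish := fun h => hcs (h.symm.trans hs.symm)
    obtain ⟨g₁, g₂⟩ := hG h₁ (by simp) h₂ (by simp) hlt₁ hlt₂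
    simp only [mirrorWt_cons] at g₁ g₂ ⊢
    have main : ∀ h : Tok X, (c.lab = h₁.lab ∧ h = h₂ ∨ c.lab = h₂.lab ∧ h = h₁) →
        ∀ t : List (Tok X), (∀ d ∈ t, d ∈ t₁ ++ t₂) →
        mirrorWt (c.recolor h₁.lab h₂.lab) (t.flatMap fun d => [d.recolor h₁.lab h₂.lab]) ≤
          mirrorWt c t + mirrorWt h t := by
      intro h hh t htt
      apply mirrorWt_flatMap_le
      intro d hd
      have := ht d (htt d hd)
      have h2 : d.finish ≠ h₂.finish := by rwa [← hs]
      simp only [mirrorWt_cons, mirrorWt_nil, Tok.recolor]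
      rcases hh with ⟨e, rfl⟩ | ⟨e, rfl⟩ <;> grind
    have main' : ¬ c.lab = h₁.lab → ¬ c.lab = h₂.lab → ∀ t : List (Tok X),
        mirrorWt (c.recolor h₁.lab h₂.lab) (t.flatMap fun d => [d.recolor h₁.lab h₂.lab]) ≤
          mirrorWt c t := by
      intro e₁ e₂ t
      apply mirrorWt_flatMap_le_self
      intro d hd
      simp only [mirrorWt_cons, mirrorWt_nil, Tok.recolor]
      grind
    by_cases e₁ : c.lab = h₁.lab
    · have m₁ := main h₂ (Or.inl ⟨e₁, rfl⟩) t₁ (by simp +contextual)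
      have m₂ := main h₂ (Or.inl ⟨e₁, rfl⟩) t₂ (by simp +contextual)
      rw [if_pos (show h₁.lab = c.lab ∧ h₁.finish ≠ c.finish from ⟨e₁.symm, hcs'⟩)]
      omega
    by_cases e₂ : c.lab = h₂.lab
    · have m₁ := main h₁ (Or.inr ⟨e₂, rfl⟩) t₁ (by simp +contextual)
      have m₂ := main h₁ (Or.inr ⟨e₂, rfl⟩) t₂ (by simp +contextual)
      rw [if_pos (show h₂.lab = c.lab ∧ h₂.finish ≠ c.finish from ⟨e₂.symm, hcs''⟩)]
      omega
    · have m₁ := main' e₁ e₂ t₁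
      have m₂ := main' e₁ e₂ t₂
      omega
  intro a' ha' c' hc' h₁' h₂'
  simp only [List.mem_flatMap, List.mem_singleton] at ha' hc'
  obtain ⟨a, ha, rfl⟩ := ha'
  obtain ⟨c, hc, rfl⟩ := hc'
  have := hG a (by simp [ha]) c (by simp [hc]) h₁' h₂'
  have k₁ := key a (by simp [ha])
  have k₂ := key c (by simp [hc])
  simp only [Tok.recolor] at *
  omega

/-- `d'` is one of the pieces of the occurrence `d`. -/
def Piece (x y : X) (k : ℤ) (d d' : Tok X) : Prop :=
  (d.lab ≠ x ∧ d' = d) ∨ (d.lab = x ∧ d' = ⟨d.start, d.start + k, y, d.wt⟩) ∨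
    (d.lab = x ∧ d' = ⟨d.start + k, d.finish, x, d.wt⟩)

theorem Tok.mem_split {x y : X} {k : ℤ} {d d' : Tok X} :
    d' ∈ d.split x y k ↔ Piece x y k d d' := by
  unfold Tok.split Piece
  split_ifs <;> simp [*]

theorem Good.split {L : X → ℤ} {o : ℤ} {x y : X} {p q : ℕ} {t₁ t₂ : List (Tok X)}
    (hG : Good (⟨o, o + L x, x, p⟩ :: t₁) (⟨o, o + L y, y, q⟩ :: t₂))
    (hy : 0 < L y) (hxy : L y < L x)
    (ht : ∀ d ∈ t₁ ++ t₂, o < d.start ∧ d.finish = d.start + L d.lab) :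
    Good (⟨o + L y, o + L x, x, p⟩ :: t₁.flatMap (Tok.split x y (L y)))
      (t₂.flatMap (Tok.split x y (L y))) := by
  have hne : y ≠ x := by rintro rfl; omega
  obtain ⟨g₁, g₂⟩ := hG ⟨o, o + L x, x, p⟩ (by simp) ⟨o, o + L y, y, q⟩ (by simp)
    (by simp only; omega) (by simp only; omega)
  simp only [mirrorWt_cons, hne, hne.symm, false_and, if_false, not_true_eq_false, ne_eq,
    and_false] at g₁ g₂
  have htx : ∀ d ∈ t₁ ++ t₂, d.lab = x → d.finish ≠ o + L x := by
    intro d hd e; have := ht d hd; rw [e] at this; omega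
  have hty : ∀ d ∈ t₁ ++ t₂, d.lab = y → d.finish ≠ o + L y := by
    intro d hd e; have := ht d hd; rw [e] at this; omega
  have key : ∀ c c', (c = ⟨o, o + L x, x, p⟩ ∧ c' = ⟨o + L y, o + L x, x, p⟩) ∨
      (c ∈ t₁ ++ t₂ ∧ Piece x y (L y) c c') →
      mirrorWt c' (⟨o + L y, o + L x, x, p⟩ :: t₁.flatMap (Tok.split x y (L y))) +
        mirrorWt c' (t₂.flatMap (Tok.split x y (L y))) ≤
      mirrorWt c (⟨o, o + L x, x, p⟩ :: t₁) + mirrorWt c (⟨o, o + L y, y, q⟩ :: t₂) := by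
    have keyX : ∀ c c' : Tok X, c.finish = c'.finish → c.lab = c'.lab → c.lab ≠ y →
        mirrorWt c' (⟨o + L y, o + L x, x, p⟩ :: t₁.flatMap (Tok.split x y (L y))) +
          mirrorWt c' (t₂.flatMap (Tok.split x y (L y))) ≤
        mirrorWt c (⟨o, o + L x, x, p⟩ :: t₁) + mirrorWt c (⟨o, o + L y, y, q⟩ :: t₂) := by
      intro c c' hs hl hy'
      have m : ∀ t : List (Tok X), mirrorWt c' (t.flatMap (Tok.split x y (L y))) ≤
          mirrorWt c t := by
        intro t
        apply mirrorWt_flatMap_le_self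
        intro d hd
        unfold Tok.split
        split_ifs <;> simp only [mirrorWt_cons, mirrorWt_nil] <;> grind
      have m₁ := m t₁
      have m₂ := m t₂
      simp only [mirrorWt_cons, hs, hl]
      omega
    rintro c c' (⟨rfl, rfl⟩ | ⟨hc, ⟨hl, rfl⟩ | ⟨hl, rfl⟩ | ⟨hl, rfl⟩⟩)
    · exact keyX _ _ rfl rfl hne.symm
    · by_cases hcy : c'.lab = y
      · have m : ∀ t : List (Tok X), (∀ d ∈ t, d ∈ t₁ ++ t₂) →
            mirrorWt c' (t.flatMap (Tok.split x y (L y))) ≤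
            mirrorWt c' t + mirrorWt ⟨o, o + L x, x, p⟩ t := by
          intro t htt
          apply mirrorWt_flatMap_le
          intro d hd
          have := htx d (htt d hd)
          unfold Tok.split
          split_ifs <;> simp only [mirrorWt_cons, mirrorWt_nil] <;> grind
        have m₁ := m t₁ (by simp +contextual)
        have m₂ := m t₂ (by simp +contextual)
        have := hty _ hc hcy
        simp only [mirrorWt_cons, hcy, hne.symm, this.symm, false_and, if_false, ne_eq,
          not_false_eq_true, and_self, if_true]
        omega
      · exact keyX _ _ rfl rfl hcy
    · have m : ∀ t : List (Tok X), (∀ d ∈ t, d ∈ t₁ ++ t₂) →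
          mirrorWt ⟨c.start, c.start + L y, y, c.wt⟩ (t.flatMap (Tok.split x y (L y))) ≤
          mirrorWt c t + mirrorWt ⟨o, o + L y, y, q⟩ t := by
        intro t htt
        apply mirrorWt_flatMap_le
        intro d hd
        have h1 := hty d (htt d hd)
        have h2 := ht d (htt d hd)
        have h3 := ht c hc
        unfold Tok.split
        split_ifs <;> simp only [mirrorWt_cons, mirrorWt_nil] <;> grind
      have m₁ := m t₁ (by simp +contextual)
      have m₂ := m t₂ (by simp +contextual)
      have := htx _ hc hl
      simp only [mirrorWt_cons, hl, hne.symm, hne, this.symm, false_and, if_false, ne_eq,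
          not_false_eq_true, and_self, if_true]
      omega
    · exact keyX _ _ rfl hl (by rw [hl]; exact hne.symm)
  have parent : ∀ c ∈ t₁ ++ t₂, ∀ c', Piece x y (L y) c c' →
      c.start ≤ c'.start ∧ c'.finish ≤ c.finish ∧ c'.wt = c.wt := by
    intro c hc c' hp
    have h := ht c hc
    rcases hp with ⟨hl, rfl⟩ | ⟨hl, rfl⟩ | ⟨hl, rfl⟩
    · simp
    · rw [hl] at h; refine ⟨?_, ?_, rfl⟩ <;> simp only <;> omega
    · refine ⟨?_, ?_, rfl⟩ <;> simp only <;> omega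
  intro a' ha' c' hc' h₁ h₂
  simp only [List.mem_cons, List.mem_flatMap, Tok.mem_split] at ha' hc'
  obtain ⟨c, hc, hc'⟩ := hc'
  have pc := parent c (by simp [hc]) c' hc'
  have kc := key c c' (Or.inr ⟨by simp [hc], hc'⟩)
  rcases ha' with rfl | ⟨a, ha, ha'⟩
  · have ka := key _ _ (Or.inl ⟨rfl, rfl⟩)
    have := hG ⟨o, o + L x, x, p⟩ (by simp) c (by simp [hc])
      (by simp only at *; omega) (by simp only at *; omega)
    simp only at *
    omega
  · have pa := parent a (by simp [ha]) a' ha'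
    have ka := key a a' (Or.inr ⟨by simp [ha], ha'⟩)
    have := hG a (by simp [ha]) c (by simp [hc]) (by omega) (by omega)
    omega

theorem mem_toks {L : X → ℕ} {o : ℤ} {w : List (X × ℕ)} {d : Tok X} (h : d ∈ toks L o w) :
    o ≤ d.start ∧ d.finish = d.start + L d.lab := by
  induction w generalizing o with
  | nil => simp [toks] at h
  | cons e w ih =>
    simp only [toks, List.mem_cons] at h
    rcases h with rfl | h
    · simp
    · have := ih h
      omega

theorem toks_recolor (L : X → ℕ) (x y : X) (o : ℤ) (w : List (X × ℕ)) :
    toks L o (w.map fun e => (if e.1 = y then x else e.1, e.2)) =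
      (toks (fun z => L (if z = y then x else z)) o w).flatMap fun d => [d.recolor x y] := by
  induction w generalizing o with
  | nil => rfl
  | cons e w ih => simp [toks, ih, Tok.recolor]

/-- The substitution `x ↦ y x` on weighted words, both pieces inheriting the weight. -/
def expandWt (x y : X) (w : List (X × ℕ)) : List (X × ℕ) :=
  w.flatMap fun e => if e.1 = x then [(y, e.2), (x, e.2)] else [e]

theorem map_fst_expandWt (x y : X) (w : List (X × ℕ)) :
    (expandWt x y w).map Prod.fst = expand x y (w.map Prod.fst) := by
  induction w with
  | nil => rfl
  | cons e w ih =>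
    simp only [expandWt, expand, List.flatMap_cons, List.map_append, List.map_cons] at ih ⊢
    rw [ih]
    split_ifs <;> simp

theorem toks_expandWt (L : X → ℕ) (x y : X) (o : ℤ) (w : List (X × ℕ)) :
    toks L o (expandWt x y w) =
      (toks (fun z => if z = x then L y + L x else L z) o w).flatMap (Tok.split x y (L y)) := by
  induction w generalizing o with
  | nil => rfl
  | cons e w ih =>
    simp only [expandWt, List.flatMap_cons, toks] at ih ⊢
    by_cases h : e.1 = x
    · simp only [h, if_true, List.cons_append, List.nil_append, toks, ih, Tok.split]
      simp [add_assoc]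
    · simp [h, toks, ih, Tok.split]

theorem sum_expandWt (L : X → ℕ) (x y : X) (o : ℤ) (h : Tok X) (hx : h.lab = x)
    (w : List (X × ℕ)) (hw : ∀ d ∈ toks L o w, d.lab = x → d.finish ≠ h.finish) :
    ((expandWt x y w).map Prod.snd).sum =
      (w.map Prod.snd).sum + mirrorWt h (toks L o w) := by
  induction w generalizing o with
  | nil => rfl
  | cons e w ih =>
    have h₁ := ih (o + L e.1) fun d hd => hw d (by simp [toks, hd])
    have h₂ := hw ⟨o, o + L e.1, e.1, e.2⟩ (by simp [toks])
    simp only [expandWt, List.flatMap_cons, List.map_append, List.sum_append, toks,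
      mirrorWt_cons, List.map_cons, List.sum_cons, hx] at h₁ h₂ ⊢
    by_cases hex : e.1 = x
    · rw [hex] at h₁ h₂ ⊢
      simp only [true_and, if_true] at h₂ ⊢
      rw [h₁, if_pos (h₂ trivial)]
      simp
      omega
    · simp only [hex, false_and, if_false]
      simp
      omega

theorem CohWitness.lt_iff {U₁ U₂ : List X} {lt : BRel} {L : X → ℕ}
    (hL : CohWitness U₁ U₂ lt L) (hbo : BoundaryOrder U₁ U₂ lt) {a b : ℕ × ℕ}
    (ha : EBoundary U₁ U₂ a) (hb : EBoundary U₁ U₂ b) :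
    lt a b ↔ prefixLen U₁ U₂ L a < prefixLen U₁ U₂ L b := by
  have e0 : ∀ i, i = 1 ∨ i = 2 → EBoundary U₁ U₂ (i, 0) := fun i hi => ⟨hi, by simp⟩
  have bot : ∀ i i', i = 1 ∨ i = 2 → i' = 1 ∨ i' = 2 → Incomp lt (i, 0) (i', 0) := by
    have hb := hbo.bot
    have h1 := hbo.irrefl _ (e0 1 (by simp))
    have h2 := hbo.irrefl _ (e0 2 (by simp))
    unfold Incomp at *
    rintro i i' (rfl | rfl) (rfl | rfl) <;> tauto
  have same : ∀ i j, EBoundary U₁ U₂ (i, j + 1) → lt (i, 0) (i, j + 1) := by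
    intro i j h
    induction j with
    | zero => exact hbo.succ i 0 h
    | succ j ih =>
      have h' : EBoundary U₁ U₂ (i, j + 1) := ⟨h.1, by have := h.2; simp only at *; omega⟩
      exact hbo.trans _ _ _ (e0 i h.1) h' h (ih h') (hbo.succ i (j + 1) h)
  have low : ∀ i i' j, (i = 1 ∨ i = 2) → EBoundary U₁ U₂ (i', j + 1) →
      lt (i, 0) (i', j + 1) ∧ ¬ lt (i', j + 1) (i, 0) := by
    intro i i' j hi h
    have hs := same i' j h
    have hb := bot i' i h.1 hi
    have hn : ¬ lt (i', j + 1) (i, 0) := fun hl =>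
      hb.1 (hbo.trans _ _ _ (e0 i' h.1) h (e0 i hi) hs hl)
    refine ⟨?_, hn⟩
    by_contra hc
    exact (hbo.incomp_trans _ _ _ (e0 i' h.1) (e0 i hi) h hb ⟨hc, hn⟩).1 hs
  have pos : ∀ i j, EBoundary U₁ U₂ (i, j + 1) → 0 < prefixLen U₁ U₂ L (i, j + 1) := by
    intro i j h
    have h2 := h.2
    unfold prefixLen
    simp only at h2 ⊢
    cases hw : word U₁ U₂ i with
    | nil => simp [hw] at h2
    | cons z l =>
      have := hL.1 z
      simp
      omega
  have zero : ∀ i, prefixLen U₁ U₂ L (i, 0) = 0 := by simp [prefixLen]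
  obtain ⟨i, _ | j⟩ := a <;> obtain ⟨i', _ | j'⟩ := b
  · simp [zero, (bot i i' ha.1 hb.1).1]
  · simp [zero, low i i' j' ha.1 hb, pos i' j' hb]
  · simp [zero, low i' i j hb.1 ha]
  · exact hL.2 _ _ ⟨ha.1, by simp, ha.2⟩ ⟨hb.1, by simp, hb.2⟩

theorem CohWitness.of_nielsenI {x y : X} {V₁ V₂ : List X} {lt lt' : BRel} {L : X → ℕ}
    (hbo : BoundaryOrder (V₁.map fun z => if z = y then x else z)
      (V₂.map fun z => if z = y then x else z) lt')
    (hlt : ∀ a b : ℕ × ℕ,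
      EBoundary (V₁.map fun z => if z = y then x else z)
        (V₂.map fun z => if z = y then x else z) a →
      EBoundary (V₁.map fun z => if z = y then x else z)
        (V₂.map fun z => if z = y then x else z) b →
      (lt' a b ↔ lt (a.1, a.2 + 1) (b.1, b.2 + 1)))
    (hL : CohWitness (V₁.map fun z => if z = y then x else z)
      (V₂.map fun z => if z = y then x else z) lt' L) :
    CohWitness (x :: V₁) (y :: V₂) lt fun z => L (if z = y then x else z) := by
  have hE : ∀ i j, Boundary (x :: V₁) (y :: V₂) (i, j + 1) →
      EBoundary (V₁.map fun z => if z = y then x else z)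
        (V₂.map fun z => if z = y then x else z) (i, j) := by
    rintro i j ⟨hi, -, h⟩
    refine ⟨hi, ?_⟩
    rcases hi with hi | hi <;> simp only at hi <;> subst hi <;> simp [word] at h ⊢ <;> exact h
  have hP : ∀ i j, Boundary (x :: V₁) (y :: V₂) (i, j + 1) →
      prefixLen (x :: V₁) (y :: V₂) (fun z => L (if z = y then x else z)) (i, j + 1) =
      L x + prefixLen (V₁.map fun z => if z = y then x else z)
        (V₂.map fun z => if z = y then x else z) L (i, j) := by
    rintro i j ⟨hi, -, -⟩
    rcases hi with hi | hi <;> simp only at hi <;> subst hi <;>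
      simp [prefixLen, word, ← List.map_take, Function.comp_def]
  refine ⟨fun z => hL.1 _, ?_⟩
  rintro ⟨i, _ | j⟩ ⟨i', _ | j'⟩ ha hb
  · exact absurd ha.2.1 (by simp)
  · exact absurd ha.2.1 (by simp)
  · exact absurd hb.2.1 (by simp)
  · rw [hP i j ha, hP i' j' hb, ← hlt (i, j) (i', j') (hE i j ha) (hE i' j' hb),
      hL.lt_iff hbo (hE i j ha) (hE i' j' hb)]
    omega

theorem Weighted.nielsenI {U₁ U₂ U₁' U₂' : List X} {lt lt' : BRel} {n : ℕ}
    (hW : Weighted U₁ U₂ lt n) (hc : Coherent U₁ U₂ lt) (hN : NielsenI U₁ U₂ lt U₁' U₂' lt') :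
    ∃ m < n, Weighted U₁' U₂' lt' m := by
  obtain ⟨x₀, y₀, hx, hy, hinc, rfl, rfl, hbo, hlt⟩ := hN
  obtain ⟨L₀, hL₀⟩ := hc
  obtain ⟨w₁, w₂, rfl, rfl, hsum, hG⟩ := hW
  obtain _ | ⟨⟨x, p⟩, v₁⟩ := w₁
  · simp at hx
  obtain _ | ⟨⟨y, q⟩, v₂⟩ := w₂
  · simp at hy
  simp only [List.map_cons, List.head?_cons, Option.some.injEq] at hx hy
  subst hx hy
  simp only [List.map_cons, List.tail_cons, List.sum_cons] at *
  have hpos : 0 < p := by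
    have hb₁ : Boundary (x :: v₁.map Prod.fst) (y :: v₂.map Prod.fst) (1, 1) := by
      simp [Boundary, word]
    have hb₂ : Boundary (x :: v₁.map Prod.fst) (y :: v₂.map Prod.fst) (2, 1) := by
      simp [Boundary, word]
    have h₁ := hL₀.1 x
    have h₂ := hL₀.1 y
    have := hG L₀ hL₀ 0 ⟨0, 0 + L₀ x, x, p⟩ (by simp [toks]) ⟨0, 0 + L₀ y, y, q⟩
      (by simp [toks]) (by simp only; omega) (by simp only; omega)
    simp only at this
    omega
  refine ⟨(v₁.map Prod.snd).sum + (v₂.map Prod.snd).sum, by omega,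
    v₁.map (fun e => (if e.1 = y then x else e.1, e.2)),
    v₂.map (fun e => (if e.1 = y then x else e.1, e.2)), by simp [Function.comp_def],
    by simp [Function.comp_def], by simp [Function.comp_def], ?_⟩
  intro L hL o
  have hL' := CohWitness.of_nielsenI hbo hlt hL
  have hg := hG _ hL' (o - L x)
  have hxx : L (if x = y then x else x) = L x := by simp
  simp only [toks, if_true, hxx, sub_add_cancel] at hg
  rw [toks_recolor, toks_recolor]
  have hLx := hL.1 x
  refine hg.recolor rfl (by simp only; omega) (by simp only; omega) ?_
  intro d hd
  simp only [List.mem_append] at hd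
  have hLd := hL.1 (if d.lab = y then x else d.lab)
  rcases hd with hd | hd <;> have := mem_toks hd <;> simp only at * <;> omega

theorem length_expand (x y : X) (l : List X) : (expand x y l).length = l.length + l.count x := by
  induction l with
  | nil => rfl
  | cons z l ih =>
    simp only [expand, List.flatMap_cons, List.length_append, List.length_cons,
      List.count_cons] at ih ⊢
    rw [ih]
    by_cases h : z = x <;> simp [h] <;> omega

theorem expand_append (x y : X) (l l' : List X) :
    expand x y (l ++ l') = expand x y l ++ expand x y l' := by
  simp [expand]

theorem expand_take (x y : X) (l : List X) (j : ℕ) (hj : j ≤ l.length) :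
    (expand x y l).take (j + (l.take j).count x) = expand x y (l.take j) := by
  conv_lhs => rw [← List.take_append_drop j l, expand_append]
  rw [List.take_append_of_le_length, List.take_of_length_le] <;>
    simp [length_expand, hj]

theorem count_expand {x y : X} (h : y ≠ x) (l : List X) :
    (expand x y l).count x = l.count x := by
  induction l with
  | nil => rfl
  | cons z l ih =>
    simp only [expand, List.flatMap_cons, List.count_append, List.count_cons] at ih ⊢
    rw [ih]
    by_cases hz : z = x 
    · simp [hz, h]
      omega
    · simp [hz]

theorem sum_expand (L : X → ℕ) (x y : X) (l : List X) :
    ((expand x y l).map L).sum =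
      (l.map fun z => if z = x then L y + L x else L z).sum := by
  induction l with
  | nil => rfl
  | cons z l ih =>
    simp only [expand, List.flatMap_cons, List.map_append, List.map_cons, List.sum_append,
      List.sum_cons] at ih ⊢
    rw [ih]
    by_cases hz : z = x <;> simp [hz]

theorem prefixLen_snd_one_lt {x y : X} {V₁ V₂ : List X} {L : X → ℕ} (hL : ∀ x, 0 < L x)
    (hxy : L y < L x) {b : ℕ × ℕ} (hb : Bminus (x :: V₁) (y :: V₂) b) :
    prefixLen (x :: V₁) (y :: V₂) L (2, 1) < prefixLen (x :: V₁) (y :: V₂) L b := by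
  obtain ⟨i, j⟩ := b
  obtain ⟨⟨rfl | rfl, h₁, h₂⟩, hne⟩ := hb
  · obtain ⟨j, rfl⟩ := Nat.exists_eq_add_of_le' h₁
    simp [prefixLen, word]
    omega
  · obtain ⟨j, rfl⟩ := Nat.exists_eq_add_of_le' h₁
    obtain _ | j := j
    · simp at hne
    · obtain _ | ⟨z, V₂⟩ := V₂
      · simp [word] at h₂
      · have := hL z
        simp [prefixLen, word]
        omega

theorem CohWitness.of_nielsenII {x y : X} {V₁ V₂ U₁' U₂' : List X} {lt lt' : BRel}
    {L₀ L : X → ℕ} (hL₀ : CohWitness (x :: V₁) (y :: V₂) lt L₀) (hxy : L₀ y < L₀ x)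
    (h₁ : expand x y (x :: V₁) = y :: U₁') (h₂ : expand x y (y :: V₂) = y :: U₂')
    (hlt : ∀ a b, Bpminus (x :: V₁) (y :: V₂) x a → Bpminus (x :: V₁) (y :: V₂) x b →
      (lt' a b ↔ lt (nu U₁' U₂' x a) (nu U₁' U₂' x b)))
    (hL : CohWitness U₁' U₂' lt' L) :
    CohWitness (x :: V₁) (y :: V₂) lt fun z => if z = x then L y + L x else L z := by
  have hne : y ≠ x := by rintro rfl; omega
  have hx := hL.1 x
  have hpos : ∀ z, 0 < (fun z => if z = x then L y + L x else L z) z := by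
    intro z
    have := hL.1 z
    simp only
    split_ifs <;> omega
  have hxy' : (fun z => if z = x then L y + L x else L z) y <
      (fun z => if z = x then L y + L x else L z) x := by
    simp [hne, hx]
  have hw : ∀ i, expand x y (word (x :: V₁) (y :: V₂) i) = y :: word U₁' U₂' i := by
    intro i
    unfold word
    split_ifs <;> assumption
  have htake : ∀ i j, 1 ≤ j → j ≤ (word (x :: V₁) (y :: V₂) i).length →
      y :: (word U₁' U₂' i).take (mu (x :: V₁) (y :: V₂) x (i, j)).2 =
        expand x y ((word (x :: V₁) (y :: V₂) i).take j) := by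
    intro i j hj hj'
    rw [← expand_take x y _ j hj', hw, ← List.take_succ_cons]
    congr 1
    simp only [mu]
    omega
  have hprefix : ∀ b, Boundary (x :: V₁) (y :: V₂) b →
      prefixLen (x :: V₁) (y :: V₂) (fun z => if z = x then L y + L x else L z) b =
        L y + prefixLen U₁' U₂' L (mu (x :: V₁) (y :: V₂) x b) := by
    rintro ⟨i, j⟩ ⟨-, hj, hj'⟩
    have := congrArg (fun l => (l.map L).sum) (htake i j hj hj')
    simp only [sum_expand, List.map_cons, List.sum_cons] at this
    unfold prefixLen
    rw [← this]
    rfl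
  have hnu : ∀ b, Boundary (x :: V₁) (y :: V₂) b →
      nu U₁' U₂' x (mu (x :: V₁) (y :: V₂) x b) = b := by
    rintro ⟨i, j⟩ ⟨-, hj, hj'⟩
    have := congrArg (List.count x) (htake i j hj hj')
    rw [count_expand hne, List.count_cons_of_ne hne] at this
    simp only [nu, mu] at this ⊢
    rw [this]
    congr 1
    omega
  have hmu : ∀ b, Bminus (x :: V₁) (y :: V₂) b →
      Boundary U₁' U₂' (mu (x :: V₁) (y :: V₂) x b) := by
    rintro ⟨i, j⟩ ⟨⟨hi, hj, hj'⟩, hb⟩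
    have hlen := congrArg List.length (hw i)
    rw [length_expand, List.length_cons] at hlen
    have hcount := ((List.take_sublist j (word (x :: V₁) (y :: V₂) i)).count_le x)
    refine ⟨hi, ?_, ?_⟩
    · simp only [mu]
      rcases hi with rfl | rfl
      · obtain ⟨j, rfl⟩ := Nat.exists_eq_add_of_le' hj
        simp [word]
        omega
      · have : j ≠ 1 := fun h => hb (by rw [h])
        omega
    · simp only [mu] at *
      omega
  refine ⟨hpos, ?_⟩
  have hmain : ∀ a b, Bminus (x :: V₁) (y :: V₂) a → Bminus (x :: V₁) (y :: V₂) b →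
      (lt a b ↔
        prefixLen (x :: V₁) (y :: V₂) (fun z => if z = x then L y + L x else L z) a <
          prefixLen (x :: V₁) (y :: V₂) (fun z => if z = x then L y + L x else L z) b) := by
    intro a b ha hb
    have := hlt _ _ ⟨a, ha, rfl⟩ ⟨b, hb, rfl⟩
    rw [hnu a ha.1, hnu b hb.1] at this
    rw [← this, hL.2 _ _ (hmu a ha) (hmu b hb), hprefix a ha.1, hprefix b hb.1]
    omega
  intro a b ha hb
  by_cases ha2 : a = (2, 1) <;> by_cases hb2 : b = (2, 1)
  · rw [hL₀.2 a b ha hb, ha2, hb2]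
    simp
  · have e₁ := prefixLen_snd_one_lt hL₀.1 hxy ⟨hb, hb2⟩
    have e₂ := prefixLen_snd_one_lt hpos hxy' ⟨hb, hb2⟩
    rw [hL₀.2 a b ha hb, ha2]
    tauto
  · have e₁ := prefixLen_snd_one_lt hL₀.1 hxy ⟨ha, ha2⟩
    have e₂ := prefixLen_snd_one_lt hpos hxy' ⟨ha, ha2⟩
    rw [hL₀.2 a b ha hb, hb2]
    omega
  · exact hmain a b ⟨ha, ha2⟩ ⟨hb, hb2⟩

theorem Weighted.nielsenII {U₁ U₂ U₁' U₂' : List X} {lt lt' : BRel} {n : ℕ}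
    (hW : Weighted U₁ U₂ lt n) (hc : Coherent U₁ U₂ lt)
    (hN : NielsenII U₁ U₂ lt U₁' U₂' lt') :
    ∃ m < n, Weighted U₁' U₂' lt' m := by
  obtain ⟨x₀, y₀, hx, hy, hlt, hU₁, hU₂, -, hlt'⟩ := hN
  obtain ⟨L₀, hL₀⟩ := hc
  replace hL₀ : CohWitness U₁ U₂ lt L₀ := hL₀
  obtain ⟨w₁, w₂, rfl, rfl, hsum, hG⟩ := hW
  obtain _ | ⟨⟨x, p⟩, v₁⟩ := w₁
  · simp at hx
  obtain _ | ⟨⟨y, q⟩, v₂⟩ := w₂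
  · simp at hy
  simp only [List.map_cons, List.head?_cons, Option.some.injEq] at hx hy
  subst hx hy
  simp only [List.map_cons, List.sum_cons] at *
  have hxy : L₀ y < L₀ x := by
    have := (hL₀.2 (2, 1) (1, 1) (by simp [Boundary, word]) (by simp [Boundary, word])).1 hlt
    simpa [prefixLen, word] using this
  have hne : y ≠ x := by rintro rfl; omega
  have h₁ : expand x y (x :: v₁.map Prod.fst) = y :: x :: expand x y (v₁.map Prod.fst) := by
    simp [expand]
  have h₂ : expand x y (y :: v₂.map Prod.fst) = y :: expand x y (v₂.map Prod.fst) := by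
    simp [expand, hne]
  rw [h₁, List.tail_cons] at hU₁
  rw [h₂, List.tail_cons] at hU₂
  subst hU₁ hU₂
  have hfinish : ∀ (L : X → ℕ), (∀ z, 0 < L z) → ∀ o : ℤ, ∀ d ∈ toks L (o + L x) v₁ ++
      toks L (o + L y) v₂, o < d.start ∧ d.finish = d.start + L d.lab := by
    intro L hL o d hd
    have hLx := hL x
    have hLy := hL y
    rw [List.mem_append] at hd
    rcases hd with hd | hd <;> have := mem_toks hd <;> omega
  have hq : mirrorWt ⟨0, 0 + L₀ x, x, p⟩ (toks L₀ (0 + L₀ x) v₁) +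
      mirrorWt ⟨0, 0 + L₀ x, x, p⟩ (toks L₀ (0 + L₀ y) v₂) < q := by
    have hy := hL₀.1 y
    have := hG L₀ hL₀ 0 ⟨0, 0 + L₀ x, x, p⟩ (by simp [toks]) ⟨0, 0 + L₀ y, y, q⟩
      (by simp [toks]) (by simp only; omega) (by simp only; omega)
    simp only [toks, mirrorWt_cons] at this
    omega
  have hs₁ := sum_expandWt L₀ x y (0 + L₀ x) ⟨0, 0 + L₀ x, x, p⟩ rfl v₁ (by
    intro d hd e
    have := hfinish L₀ hL₀.1 0 d (List.mem_append_left _ hd)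
    rw [e] at this
    simp only
    omega)
  have hs₂ := sum_expandWt L₀ x y (0 + L₀ y) ⟨0, 0 + L₀ x, x, p⟩ rfl v₂ (by
    intro d hd e
    have := hfinish L₀ hL₀.1 0 d (List.mem_append_right _ hd)
    rw [e] at this
    simp only
    omega)
  refine ⟨_, ?_, (x, p) :: expandWt x y v₁, expandWt x y v₂, by simp [map_fst_expandWt],
    by simp [map_fst_expandWt], rfl, ?_⟩
  · simp only [List.map_cons, List.sum_cons]
    omega
  intro L hL o
  have hL' := hL₀.of_nielsenII hxy h₁ h₂ hlt' hL
  have hg := hG _ hL' (o - L y)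
  have hst := hfinish _ hL'.1 (o - L y)
  have hLx := hL.1 x
  have hLy := hL.1 y
  have := Good.split (L := fun z => ((if z = x then L y + L x else L z : ℕ) : ℤ))
    (o := o - L y) (x := x) (y := y) (p := p) (q := q) hg
    (by simp [hne, hLy]) (by simp [hne, hLx]) hst
  have e : o - (L y : ℤ) + ((L y + L x : ℕ) : ℤ) = o + L x := by
    push_cast
    ring
  simp only [hne, if_true, if_false, e, sub_add_cancel] at this
  simp only [toks]
  rw [toks_expandWt, toks_expandWt]
  exact this

theorem CohWitness.dual {U₁ U₂ : List X} {lt : BRel} {L : X → ℕ}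
    (hL : CohWitness U₁ U₂ lt L) : CohWitness U₂ U₁ (dualRel lt) L := by
  refine ⟨hL.1, ?_⟩
  rintro ⟨i, j⟩ ⟨i', j'⟩ ⟨hi, hj⟩ ⟨hi', hj'⟩
  simp only at hi hi'
  have := hL.2 (3 - i, j) (3 - i', j')
  rcases hi with rfl | rfl <;> rcases hi' with rfl | rfl <;>
    simp_all [Boundary, word, prefixLen, dualRel]

theorem CohWitness.of_dual {U₁ U₂ : List X} {lt : BRel} {L : X → ℕ}
    (hL : CohWitness U₂ U₁ (dualRel lt) L) : CohWitness U₁ U₂ lt L := by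
  refine ⟨hL.1, ?_⟩
  rintro ⟨i, j⟩ ⟨i', j'⟩ ⟨hi, hj⟩ ⟨hi', hj'⟩
  simp only at hi hi'
  have := hL.2 (3 - i, j) (3 - i', j')
  rcases hi with rfl | rfl <;> rcases hi' with rfl | rfl <;>
    simp_all [Boundary, word, prefixLen, dualRel]

theorem Weighted.dual {U₁ U₂ : List X} {lt : BRel} {n : ℕ} (h : Weighted U₁ U₂ lt n) :
    Weighted U₂ U₁ (dualRel lt) n := by
  obtain ⟨w₁, w₂, h₁, h₂, hs, hG⟩ := h
  exact ⟨w₂, w₁, h₂, h₁, by omega, fun L hL o => (hG L hL.of_dual o).symm⟩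

theorem Weighted.of_dual {U₁ U₂ : List X} {lt : BRel} {n : ℕ}
    (h : Weighted U₂ U₁ (dualRel lt) n) : Weighted U₁ U₂ lt n := by
  obtain ⟨w₁, w₂, h₁, h₂, hs, hG⟩ := h
  exact ⟨w₂, w₁, h₂, h₁, by omega, fun L hL o => (hG L hL.dual o).symm⟩

theorem Weighted.cohNielsen {U₁ U₂ U₁' U₂' : List X} {lt lt' : BRel} {n : ℕ}
    (hW : Weighted U₁ U₂ lt n) (hN : CohNielsen U₁ U₂ lt U₁' U₂' lt') :
    ∃ m < n, Weighted U₁' U₂' lt' m := by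
  obtain ⟨⟨-, -, -, hc, hN | hN | hN⟩, -⟩ := hN
  · exact hW.nielsenI hc hN
  · exact hW.nielsenII hc hN
  · obtain ⟨L, hL⟩ := hc
    obtain ⟨m, hm, h⟩ := hW.dual.nielsenII ⟨L, CohWitness.dual hL⟩ hN
    exact ⟨m, hm, h.of_dual⟩

/-- A finite acyclic graph has a vertex weighting of total less than `2 ^ |S|` in which each
vertex outweighs its out-neighbours together. -/
theorem exists_weight_of_acyclic {V : Type*} (R : V → V → Prop)
    (hR : ∀ v, ¬ Relation.TransGen R v v) (S : Finset V) :
    ∃ f : V → ℕ, (∀ a ∈ S, 1 + ∑ b ∈ S with R a b, f b ≤ f a) ∧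
      ∑ b ∈ S, f b + 1 ≤ 2 ^ S.card := by
  induction hn : S.card generalizing S with
  | zero =>
    obtain rfl := Finset.card_eq_zero.1 hn
    exact ⟨0, by simp⟩
  | succ n ih =>
    have hwf : WellFounded fun a b : S => Relation.TransGen R a b :=
      @Finite.wellFounded_of_trans_of_irrefl _ _ _ ⟨fun a b c h h' => h.trans h'⟩
        ⟨fun a => hR a⟩
    have hS : S.Nonempty := by
      rw [← Finset.card_pos]
      omega
    obtain ⟨⟨v, hv⟩, -, hmin⟩ := hwf.has_min Set.univ ⟨⟨_, hS.choose_spec⟩, trivial⟩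
    have hcard : (S.erase v).card = n := by
      rw [Finset.card_erase_of_mem hv]
      omega
    obtain ⟨f, hf, hsum⟩ := ih (S.erase v) hcard
    have hfv : ∀ a ∈ S.erase v, Function.update f v (1 + ∑ b ∈ S.erase v, f b) a = f a := by
      intro a ha
      rw [Function.update_of_ne (Finset.ne_of_mem_erase ha)]
    have hin : ∀ a ∈ S, ¬ R a v := fun a ha h =>
      hmin ⟨a, ha⟩ trivial (Relation.TransGen.single h)
    have hfilter : ∀ a ∈ S, {b ∈ S | R a b} = {b ∈ S.erase v | R a b} := by
      intro a ha
      ext b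
      simp only [Finset.mem_filter, Finset.mem_erase]
      refine ⟨fun h => ⟨⟨?_, h.1⟩, h.2⟩, fun h => ⟨h.1.2, h.2⟩⟩
      rintro rfl
      exact hin a ha h.2
    refine ⟨Function.update f v (1 + ∑ b ∈ S.erase v, f b), ?_, ?_⟩
    · intro a ha
      rw [hfilter a ha, Finset.sum_congr rfl fun b hb => hfv b (Finset.mem_filter.1 hb).1]
      by_cases hav : a = v
      · subst hav
        rw [Function.update_self]
        exact Nat.add_le_add_left (Finset.sum_le_sum_of_subset (Finset.filter_subset _ _)) 1
      · have ha' := Finset.mem_erase.2 ⟨hav, ha⟩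
        rw [hfv a ha']
        exact hf a ha'
    · rw [← Finset.add_sum_erase S _ hv, Function.update_self, Finset.sum_congr rfl hfv,
        pow_succ, mul_two]
      exact (Nat.le_of_eq (by ring)).trans (Nat.add_le_add hsum hsum)

theorem Acyclic.not_transGen {U₁ U₂ : List X} {lt : BRel} (h : Acyclic U₁ U₂ lt)
    (a : ℕ × ℕ) : ¬ Relation.TransGen (CutEdge U₁ U₂ lt) a a := by
  have walk : ∀ b, Relation.TransGen (CutEdge U₁ U₂ lt) a b → ∃ (n : ℕ) (w : ℕ → ℕ × ℕ),
      0 < n ∧ w 0 = a ∧ w n = b ∧ ∀ k < n, CutEdge U₁ U₂ lt (w k) (w (k + 1)) := by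
    intro b hb
    induction hb with
    | single hab =>
      rename_i b
      exact ⟨1, fun k => if k = 0 then a else b, by simp, by simp, by simp, by simpa using hab⟩
    | tail _ hbc ih =>
      rename_i b c _
      obtain ⟨n, w, hn, h0, hb, hw⟩ := ih
      refine ⟨n + 1, fun k => if k ≤ n then w k else c, by simp, by simp [h0], by simp, ?_⟩
      intro k hk
      rcases (Nat.lt_succ_iff.1 hk).lt_or_eq with hk | rfl
      · simpa [hk.le, Nat.succ_le_of_lt hk] using hw k hk
      · simpa [hb] using hbc
  intro haa
  obtain ⟨n, w, hn, h0, hwn, hw⟩ := walk a haa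
  exact h ⟨n, w, hn, hwn.trans h0.symm, hw⟩

theorem toks_ofFn (L : X → ℕ) (o : ℤ) (U : List X) (g : Fin U.length → ℕ) :
    toks L o (List.ofFn fun j => (U.get j, g j)) =
      List.ofFn fun j : Fin U.length => (⟨o + ((U.take j).map L).sum,
        o + ((U.take (j + 1)).map L).sum, U.get j, g j⟩ : Tok X) := by
  induction U generalizing o with
  | nil => rfl
  | cons z U ih =>
    have := ih (o + L z) fun j => g j.succ
    simp only [List.length_cons, List.ofFn_succ, toks]
    refine congrArg₂ List.cons (by simp) (Eq.trans this ?_)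
    congr 1
    funext j
    simp [add_assoc]

/-- The boundary with a given word and (0-indexed) position in it. -/
def boundaryIdx {m n : ℕ} : Fin m ⊕ Fin n → ℕ × ℕ :=
  Sum.elim (fun j => (1, j + 1)) fun j => (2, j + 1)

/-- The occurrence ending at a given boundary of an equation laid out from position `o`. -/
def occurrence (U₁ U₂ : List X) (L : X → ℕ) (o : ℤ) (f : Fin U₁.length ⊕ Fin U₂.length → ℕ)
    (v : Fin U₁.length ⊕ Fin U₂.length) : Tok X :=
  ⟨o + prefixLen U₁ U₂ L ((boundaryIdx v).1, (boundaryIdx v).2 - 1),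
    o + prefixLen U₁ U₂ L (boundaryIdx v), Sum.elim U₁.get U₂.get v, f v⟩

theorem boundary_boundaryIdx (U₁ U₂ : List X) (v : Fin U₁.length ⊕ Fin U₂.length) :
    Boundary U₁ U₂ (boundaryIdx v) := by
  rcases v with j | j <;> simp [Boundary, boundaryIdx, word, Nat.succ_le_of_lt j.isLt]

theorem letter_boundaryIdx (U₁ U₂ : List X) (v : Fin U₁.length ⊕ Fin U₂.length) :
    letter U₁ U₂ (boundaryIdx v) = some (Sum.elim U₁.get U₂.get v) := by
  rcases v with j | j <;> simp [letter, boundaryIdx, word]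

theorem mirrorWt_ofFn (c : Tok X) {m : ℕ} (T : Fin m → Tok X) :
    mirrorWt c (List.ofFn T) =
      ∑ j, if (T j).lab = c.lab ∧ (T j).finish ≠ c.finish then (T j).wt else 0 := by
  rw [mirrorWt, List.map_ofFn, List.sum_ofFn]
  rfl

theorem CohWitness.one_add_mirrorWt_le {U₁ U₂ : List X} {lt : BRel} {L : X → ℕ}
    (hL : CohWitness U₁ U₂ lt L) (hbo : BoundaryOrder U₁ U₂ lt)
    {f : Fin U₁.length ⊕ Fin U₂.length → ℕ}
    (hf : ∀ a, 1 + ∑ b with CutEdge U₁ U₂ lt (boundaryIdx a) (boundaryIdx b), f b ≤ f a)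
    (o : ℤ) {a c : Fin U₁.length ⊕ Fin U₂.length} (hac : boundaryIdx a ≠ boundaryIdx c)
    (h₁ : (occurrence U₁ U₂ L o f a).start < (occurrence U₁ U₂ L o f c).finish)
    (h₂ : (occurrence U₁ U₂ L o f c).start < (occurrence U₁ U₂ L o f a).finish) :
    1 + (mirrorWt (occurrence U₁ U₂ L o f c)
          (List.ofFn fun j => occurrence U₁ U₂ L o f (Sum.inl j)) +
        mirrorWt (occurrence U₁ U₂ L o f c)
          (List.ofFn fun j => occurrence U₁ U₂ L o f (Sum.inr j))) ≤ f a := by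
  have hE : ∀ v : Fin U₁.length ⊕ Fin U₂.length, EBoundary U₁ U₂ (boundaryIdx v) := fun v =>
    ⟨(boundary_boundaryIdx U₁ U₂ v).1, (boundary_boundaryIdx U₁ U₂ v).2.2⟩
  have hE' : ∀ v : Fin U₁.length ⊕ Fin U₂.length,
      EBoundary U₁ U₂ ((boundaryIdx v).1, (boundaryIdx v).2 - 1) := fun v =>
    ⟨(hE v).1, (Nat.sub_le _ _).trans (hE v).2⟩
  have hcut : Cuts U₁ U₂ lt (boundaryIdx a) (boundaryIdx c) := by
    refine ⟨boundary_boundaryIdx U₁ U₂ a, boundary_boundaryIdx U₁ U₂ c, hac, ?_, ?_⟩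
    · rw [hL.lt_iff hbo (hE' a) (hE c)]
      simpa [occurrence] using h₁
    · rw [hL.lt_iff hbo (hE' c) (hE a)]
      simpa [occurrence] using h₂
  refine le_trans (Nat.add_le_add_left ?_ 1) (hf a)
  rw [mirrorWt_ofFn, mirrorWt_ofFn, ← Fintype.sum_sum_type fun b =>
    if (occurrence U₁ U₂ L o f b).lab = (occurrence U₁ U₂ L o f c).lab ∧
      (occurrence U₁ U₂ L o f b).finish ≠ (occurrence U₁ U₂ L o f c).finish
    then (occurrence U₁ U₂ L o f b).wt else 0, ← Finset.sum_filter]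
  refine Finset.sum_le_sum_of_subset fun b hb => ?_
  simp only [Finset.mem_filter, Finset.mem_univ, true_and] at hb ⊢
  refine ⟨_, hcut, boundary_boundaryIdx U₁ U₂ c, boundary_boundaryIdx U₁ U₂ b, ?_, Or.inl ?_⟩
  · rw [letter_boundaryIdx, letter_boundaryIdx]
    exact congrArg some hb.1.symm
  · intro hi
    have hne := hb.2
    rw [Incomp, hL.lt_iff hbo (hE c) (hE b), hL.lt_iff hbo (hE b) (hE c)] at hi
    simp only [occurrence] at hne
    omega

theorem Weighted.of_acyclic {U₁ U₂ : List X} {lt : BRel} (hbo : BoundaryOrder U₁ U₂ lt)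
    (hacyc : Acyclic U₁ U₂ lt) :
    ∃ n, n < 2 ^ (U₁.length + U₂.length) ∧ Weighted U₁ U₂ lt n := by
  obtain ⟨f, hf, hsum⟩ := exists_weight_of_acyclic
    (fun a b : Fin U₁.length ⊕ Fin U₂.length => CutEdge U₁ U₂ lt (boundaryIdx a) (boundaryIdx b))
    (fun v hv => hacyc.not_transGen (boundaryIdx v) (hv.lift boundaryIdx fun _ _ h => h))
    Finset.univ
  rw [Finset.card_univ, Fintype.card_sum, Fintype.card_fin, Fintype.card_fin,
    Fintype.sum_sum_type] at hsum
  refine ⟨_, hsum, List.ofFn fun j => (U₁.get j, f (Sum.inl j)),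
    List.ofFn fun j => (U₂.get j, f (Sum.inr j)), ?_, ?_, ?_, ?_⟩
  · rw [List.map_ofFn]
    exact List.ofFn_get U₁
  · rw [List.map_ofFn]
    exact List.ofFn_get U₂
  · rw [List.map_ofFn, List.map_ofFn, List.sum_ofFn, List.sum_ofFn]
    rfl
  · intro L hL o
    have e₁ : toks L o (List.ofFn fun j => (U₁.get j, f (Sum.inl j))) =
        List.ofFn fun j => occurrence U₁ U₂ L o f (Sum.inl j) := by
      rw [toks_ofFn]
      simp [occurrence, boundaryIdx, prefixLen, word]
    have e₂ : toks L o (List.ofFn fun j => (U₂.get j, f (Sum.inr j))) =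
        List.ofFn fun j => occurrence U₁ U₂ L o f (Sum.inr j) := by
      rw [toks_ofFn]
      simp [occurrence, boundaryIdx, prefixLen, word]
    rw [e₁, e₂]
    intro a ha c hc h₁ h₂
    obtain ⟨i, rfl⟩ := List.mem_ofFn.1 ha
    obtain ⟨j, rfl⟩ := List.mem_ofFn.1 hc
    have hij : boundaryIdx (Sum.inl i : Fin U₁.length ⊕ Fin U₂.length) ≠
        boundaryIdx (Sum.inr j : Fin U₁.length ⊕ Fin U₂.length) := by simp [boundaryIdx]
    replace hf := fun a => hf a (Finset.mem_univ a)
    exact ⟨hL.one_add_mirrorWt_le hbo hf o hij h₁ h₂,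
      hL.one_add_mirrorWt_le hbo hf o hij.symm h₂ h₁⟩

theorem Weighted.length_le (k : ℕ) (g : ℕ → List X × List X × BRel) {n : ℕ}
    (hW : Weighted (g 0).1 (g 0).2.1 (g 0).2.2 n)
    (hg : ∀ i < k, CohNielsen (g i).1 (g i).2.1 (g i).2.2
      (g (i + 1)).1 (g (i + 1)).2.1 (g (i + 1)).2.2) : k ≤ n := by
  induction k generalizing g n with
  | zero => exact Nat.zero_le n
  | succ k ih =>
    obtain ⟨m, hm, hW'⟩ := hW.cohNielsen (hg 0 k.succ_pos)
    exact (ih (fun i => g (i + 1)) hW' fun i hi => hg (i + 1) (Nat.succ_lt_succ hi)).trans_lt hm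

/-- **Theorem (sufficient condition for termination).**
If `(U₁,U₂,<)` is a coherent extended word equation whose cut graph is acyclic, then
it is terminating, and moreover every sequence of coherent extended Nielsen
transformations starting from it has length at most `2^(|U₁|+|U₂|)`. -/
theorem terminating_of_acyclic_cut_graph (U₁ U₂ : List X) (lt : BRel)
    (hbo : BoundaryOrder U₁ U₂ lt) (hcoh : Coherent U₁ U₂ lt)
    (hacyc : Acyclic U₁ U₂ lt) :
    Terminating U₁ U₂ lt ∧
      ∀ (k : ℕ) (g : ℕ → List X × List X × BRel),
        g 0 = (U₁, U₂, lt) →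
        (∀ n < k, CohNielsen (g n).1 (g n).2.1 (g n).2.2
          (g (n + 1)).1 (g (n + 1)).2.1 (g (n + 1)).2.2) →
        k ≤ 2 ^ (U₁.length + U₂.length) := by
  obtain ⟨n, hn, hW⟩ := Weighted.of_acyclic hbo hacyc
  refine ⟨?_, ?_⟩
  · rintro ⟨f, h0, hf⟩
    have := Weighted.length_le (n + 1) f (by rw [h0]; exact hW) fun i _ => hf i
    omega
  · intro k g h0 hg
    exact (Weighted.length_le k g (by rw [h0]; exact hW) hg).trans hn.le

end ExtWordEq
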